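/- Consider integers s, s', Δ such that s ≥ s' ≥ 100·log n and s'/(8Δ) ≥ 10·log s. Let H be an n-vertex graph and c : V(H) → Ω an equitable colouring such that the disparity graph D(H,c) is s-bounded and has maximum degree at most Δ. Let c' be a random refinement of c, obtained by independently, for each vertex, assigning it a new colour unique to that vertex with probability at least 0.7 (and otherwise keeping its colour under c). Then with high probability (uniformly over all choices of H, c, s, s', Δ and the individual recolouring probabilities) the disparity graph D(H, V*c') is s'-bounded. -/

import Mathlib

open MeasureTheory Filter

/-- Product of (independent) Bernoulli distributions on `ι → Bool`, with
success probability `q i` in coordinate `i`. -/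
noncomputable def bernoulliProduct (ι : Type*) [Fintype ι] [DecidableEq ι] (q : ι → ℝ) :
    Measure (ι → Bool) :=
  ∑ f : ι → Bool,
    (∏ i : ι, if f i then ENNReal.ofReal (q i) else ENNReal.ofReal (1 - q i)) •
      Measure.dirac f

/-- The Erdős–Rényi measure: each (potential) edge of the complete graph on `Fin n`
is present independently with probability `p`; encoded as a random `Sym2 (Fin n) → Bool`. -/
noncomputable def erdosRenyiMeasure (n : ℕ) (p : ℝ) : Measure (Sym2 (Fin n) → Bool) :=
  bernoulliProduct (Sym2 (Fin n)) fun _ => p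

/-- The graph on `Fin n` determined by an edge-indicator function. -/
def graphOfFlip {n : ℕ} (f : Sym2 (Fin n) → Bool) : SimpleGraph (Fin n) :=
  SimpleGraph.fromRel fun u v => f s(u, v) = true

/-- Symmetric difference of two graphs on the same vertex set. -/
def symmDiffG {V : Type*} (G₁ G₂ : SimpleGraph V) : SimpleGraph V :=
  SimpleGraph.fromRel fun u v => Xor' (G₁.Adj u v) (G₂.Adj u v)

/-- `crEquiv G c t u v` : vertices `u` and `v` get the same colour after `t` rounds of
colour refinement on `G`, starting from the colouring `c`. -/
def crEquiv {V : Type*} {Ω : Type*} (G : SimpleGraph V) (c : V → Ω) : ℕ → V → V → Prop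
  | 0, u, v => c u = c v
  | (t + 1), u, v => crEquiv G c t u v ∧ ∀ w : V,
      Nat.card {x : V // G.Adj u x ∧ crEquiv G c t x w} =
      Nat.card {x : V // G.Adj v x ∧ crEquiv G c t x w}

/-- `u` and `v` get the same colour in the stable colouring `R* c`. -/
def crStable {V : Type*} {Ω : Type*} (G : SimpleGraph V) (c : V → Ω) (u v : V) : Prop :=
  ∀ t, crEquiv G c t u v

/-- `u` and `v` get the same colour in the stable colouring `R* σ`
(colour refinement started from the trivial colouring). -/
def crStableTrivial {V : Type*} (G : SimpleGraph V) (u v : V) : Prop :=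
  crStable G (fun _ => (0 : ℕ)) u v

/-- Equality of the initial pair-colourings `φ_{G,c}` on two ordered pairs of vertices. -/
def wl2Init {V : Type*} {Ω : Type*} (G : SimpleGraph V) (c : V → Ω) (p q : V × V) : Prop :=
  (G.Adj p.1 p.2 ↔ G.Adj q.1 q.2) ∧ (p.1 = p.2 ↔ q.1 = q.2) ∧
    (p.1 = p.2 → q.1 = q.2 → c p.2 = c q.2)

/-- `wl2Equiv G c t p q` : the ordered pairs `p` and `q` get the same colour after `t` rounds of
the 2-dimensional Weisfeiler–Leman refinement on `G`, started from `φ_{G,c}`. -/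
def wl2Equiv {V : Type*} {Ω : Type*} (G : SimpleGraph V) (c : V → Ω) :
    ℕ → V × V → V × V → Prop
  | 0, p, q => wl2Init G c p q
  | (t + 1), p, q => wl2Equiv G c t p q ∧ ∀ r s : V × V,
      Nat.card {w : V // wl2Equiv G c t (p.1, w) r ∧ wl2Equiv G c t (w, p.2) s} =
      Nat.card {w : V // wl2Equiv G c t (q.1, w) r ∧ wl2Equiv G c t (w, q.2) s}

/-- `u` and `v` get the same colour in the vertex colouring `V* c` obtained from the stable
pair colouring of the 2-dimensional Weisfeiler–Leman algorithm started from `φ_{G,c}`. -/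
def wl2VertexEquiv {V : Type*} {Ω : Type*} (G : SimpleGraph V) (c : V → Ω) (u v : V) : Prop :=
  ∀ t, wl2Equiv G c t (u, u) (v, v)

/-- Given a colouring of `V(H)` encoded as the equivalence relation `r` ("has the same colour"),
`majority H r u v` says that at least half of the possible edges between the colour class of `u`
and the colour class of `v` are present in `H` (counting ordered pairs). -/
def majority {V : Type*} (H : SimpleGraph V) (r : V → V → Prop) (u v : V) : Prop :=
  Nat.card {p : V × V // p.1 ≠ p.2 ∧ r p.1 u ∧ r p.2 v} ≤
    2 * Nat.card {p : V × V // p.1 ≠ p.2 ∧ r p.1 u ∧ r p.2 v ∧ H.Adj p.1 p.2}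

/-- The disparity graph `D(H,c)`, for the colouring encoded by the relation `r`. -/
def disparity {V : Type*} (H : SimpleGraph V) (r : V → V → Prop) : SimpleGraph V :=
  SimpleGraph.fromRel fun u v => Xor' (H.Adj u v) (majority H r u v)

/-- The generalised disparity graph `D_L(H,c)` for a 0-1 matrix `L` on colours. -/
def gDisparity {V : Type*} {Ω : Type*} (H : SimpleGraph V) (c : V → Ω) (L : Ω → Ω → Bool) :
    SimpleGraph V :=
  SimpleGraph.fromRel fun u v => Xor' (H.Adj u v) (L (c u) (c v) = true)

/-- The vertex set of the connected component of `v` in `G`. -/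
def compSet {V : Type*} (G : SimpleGraph V) (v : V) : Set V := {u | G.Reachable v u}

/-- A colouring is equitable if any two vertices with the same colour have the same number of
neighbours in every colour class. -/
def IsEquitable {V : Type*} {Ω : Type*} (H : SimpleGraph V) (c : V → Ω) : Prop :=
  ∀ u v, c u = c v → ∀ a : Ω,
    Nat.card {x : V // H.Adj u x ∧ c x = a} = Nat.card {x : V // H.Adj v x ∧ c x = a}

/-- Vertex set of the `k`-core of `G`: the union of all vertex sets inducing minimum
degree at least `k`. -/
def kCore {V : Type*} (G : SimpleGraph V) (k : ℕ) : Set V :=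
  ⋃₀ {S : Set V | ∀ v ∈ S, k ≤ Nat.card {u : V // u ∈ S ∧ G.Adj v u}}

/-- `V_{2,3}(G)`: vertices of the 2-core of `G` having degree at least 3 in the 2-core. -/
def V23 {V : Type*} (G : SimpleGraph V) : Set V :=
  {v | v ∈ kCore G 2 ∧ 3 ≤ Nat.card {u : V // u ∈ kCore G 2 ∧ G.Adj v u}}

/-- The graph obtained from `G` by deleting all edges meeting `T`
(so that reachability in `avoidG G T` from `v ∉ T` is reachability in `G - T`). -/
def avoidG {V : Type*} (G : SimpleGraph V) (T : Set V) : SimpleGraph V :=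
  SimpleGraph.fromRel fun u v => G.Adj u v ∧ u ∉ T ∧ v ∉ T

/-- `V_{2,3}^{safe}(G)`: vertices `v ∈ V_{2,3}(G)` such that after deleting any set of at most
two other vertices, the component of `v` still contains at least 3 vertices of `V_{2,3}(G)`. -/
def V23safe {V : Type*} (G : SimpleGraph V) : Set V :=
  {v | v ∈ V23 G ∧ ∀ T : Finset V, T.card ≤ 2 → v ∉ T →
    3 ≤ Nat.card {w : V // w ∈ V23 G ∧ (avoidG G (T : Set V)).Reachable v w}}

open Classical in
/-- `Lmul G i u v w` is the multiplicity of the vertex `w` in the multiset `L^i_G(u,v)`. -/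
noncomputable def Lmul {V : Type*} [Fintype V] (G : SimpleGraph V) : ℕ → V → V → V → ℕ
  | 0, u, _, w => if w = u then 1 else 0
  | (i + 1), u, v, w =>
      (∑ x : V, if G.Adj w x then Lmul G i u v x else 0) -
        (∑ x : V, if G.Adj w x then Lmul G i v u x else 0)

/-- Union over `j < i` of the supports of `L^j_G(u,v)` and `L^j_G(v,u)`. -/
noncomputable def Sbelow {V : Type*} [Fintype V] (G : SimpleGraph V) (u v : V) (i : ℕ) :
    Set V :=
  {w | ∃ j < i, 0 < Lmul G j u v w ∨ 0 < Lmul G j v u w}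

/-- `S^{≤ i}_G({u,v})`. -/
noncomputable def Sle {V : Type*} [Fintype V] (G : SimpleGraph V) (u v : V) (i : ℕ) : Set V :=
  Sbelow G u v (i + 1)

/-- `S^{i}_G({u,v}) = S^{≤ i}_G({u,v}) \ S^{≤ i-1}_G({u,v})`. -/
noncomputable def Sat {V : Type*} [Fintype V] (G : SimpleGraph V) (u v : V) (i : ℕ) : Set V :=
  Sbelow G u v (i + 1) \ Sbelow G u v i

/-- Degree of a vertex (as `Nat.card` of the neighbour set, avoiding decidability issues). -/
noncomputable def ncDegree {V : Type*} (G : SimpleGraph V) (v : V) : ℕ :=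
  Nat.card {u : V // G.Adj v u}

/-- The random refinement of a colouring `c`: each vertex `v` with `f v = true` receives
a brand-new colour unique to itself. -/
def refineColor {V : Type*} {Ω : Type*} (c : V → Ω) (f : V → Bool) : V → Ω ⊕ V :=
  fun v => if f v then Sum.inr v else Sum.inl (c v)

/-- `D(H,c)` (for the colouring encoded by the relation `r`) is `s`-bounded: every
intersection of a colour class with a connected component of `D(H,c)` has at most
`s` elements. -/
def sBounded {V : Type*} (H : SimpleGraph V) (r : V → V → Prop) (s : ℕ) : Prop :=
  ∀ u v : V, Nat.card {w : V // r w u ∧ w ∈ compSet (disparity H r) v} ≤ s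

/-- The type of canonical colours after `t` rounds of colour refinement. -/
def CCol : ℕ → Type
  | 0 => Unit
  | (t + 1) => CCol t × Multiset (CCol t)

open Classical in
/-- The canonical colour of a vertex after `t` rounds of colour refinement. -/
noncomputable def canonColor {V : Type*} [Fintype V] (G : SimpleGraph V) :
    (t : ℕ) → V → CCol t
  | 0, _ => ()
  | (t + 1), v =>
      (canonColor G t v, (Finset.univ.filter fun w => G.Adj v w).val.map (canonColor G t))

/-- The modal probability `M(m,p)` of a `Binomial(m,p)` random variable. -/
noncomputable def modalProb (m : ℕ) (p : ℝ) : ℝ :=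
  (m.choose ⌊(m + 1 : ℝ) * p⌋₊ : ℝ) * p ^ ⌊(m + 1 : ℝ) * p⌋₊ *
    (1 - p) ^ (m - ⌊(m + 1 : ℝ) * p⌋₊)



section WeisfeilerLeman

variable {V : Type*}

/-- An equivalence relation on ordered pairs of vertices which is stable under 2-dimensional
Weisfeiler–Leman refinement. -/
structure IsWLStable (E : V × V → V × V → Prop) : Prop where
  equiv : Equivalence E
  diag {p q : V × V} : E p q → (p.1 = p.2 ↔ q.1 = q.2)
  exists_perm {p q : V × V} : E p q → ∃ σ : Equiv.Perm V,
    ∀ w, E (p.1, w) (q.1, σ w) ∧ E (w, p.2) (σ w, q.2)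

/-- Two maps whose fibres have the same sizes differ by a permutation of the domain. -/
theorem exists_perm_of_card_fiber_eq [Finite V] {κ : Type*} (g g' : V → κ)
    (h : ∀ k, Nat.card {w // g w = k} = Nat.card {w // g' w = k}) :
    ∃ σ : Equiv.Perm V, ∀ w, g' (σ w) = g w := by
  let e : ∀ k, {w // g w = k} ≃ {w // g' w = k} := fun k => (Finite.card_eq.1 (h k)).some
  refine ⟨(Equiv.sigmaFiberEquiv g).symm.trans
    ((Equiv.sigmaCongrRight e).trans (Equiv.sigmaFiberEquiv g')), fun w => ?_⟩
  exact (e (g w) ⟨w, rfl⟩).2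

variable {Ω : Type*} (G : SimpleGraph V) (c : V → Ω)

/-- `p` and `q` get the same colour in the stable pair colouring. -/
def wl2Stable (p q : V × V) : Prop := ∀ t, wl2Equiv G c t p q

theorem wl2Equiv_equivalence (t : ℕ) : Equivalence (wl2Equiv G c t) := by
  induction t with
  | zero =>
    refine ⟨fun p => ⟨Iff.rfl, Iff.rfl, fun _ _ => rfl⟩, fun {p q} h => ?_, fun {p q r} h h' => ?_⟩
    · exact ⟨h.1.symm, h.2.1.symm, fun a b => (h.2.2 b a).symm⟩
    · exact ⟨h.1.trans h'.1, h.2.1.trans h'.2.1, fun a b =>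
        (h.2.2 a (h.2.1.1 a)).trans (h'.2.2 (h.2.1.1 a) b)⟩
  | succ t ih =>
    exact ⟨fun p => ⟨ih.refl p, fun _ _ => rfl⟩,
      fun h => ⟨ih.symm h.1, fun r s => (h.2 r s).symm⟩,
      fun h h' => ⟨ih.trans h.1 h'.1, fun r s => (h.2 r s).trans (h'.2 r s)⟩⟩

theorem wl2Equiv_antitone {t t' : ℕ} (h : t ≤ t') {p q : V × V} (hpq : wl2Equiv G c t' p q) :
    wl2Equiv G c t p q := by
  induction h with
  | refl => exact hpq
  | step _ ih => exact ih hpq.1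

theorem exists_wl2Equiv_iff_wl2Stable [Finite V] :
    ∃ T, ∀ p q, wl2Equiv G c T p q ↔ wl2Stable G c p q := by
  classical
  have := Fintype.ofFinite V
  have h : ∀ x : (V × V) × (V × V), ∃ t, wl2Equiv G c t x.1 x.2 → wl2Stable G c x.1 x.2 := by
    intro x
    by_cases hx : wl2Stable G c x.1 x.2
    · exact ⟨0, fun _ => hx⟩
    · obtain ⟨t, ht⟩ := not_forall.1 hx
      exact ⟨t, fun h => absurd h ht⟩
  choose τ hτ using h
  refine ⟨Finset.univ.sup τ, fun p q => ⟨fun hpq => hτ (p, q) ?_, fun h => h _⟩⟩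
  exact wl2Equiv_antitone G c (Finset.le_sup (Finset.mem_univ (p, q))) hpq

theorem isWLStable_wl2Stable [Finite V] : IsWLStable (wl2Stable G c) := by
  have heq : Equivalence (wl2Stable G c) :=
    ⟨fun p t => (wl2Equiv_equivalence G c t).refl p,
      fun h t => (wl2Equiv_equivalence G c t).symm (h t),
      fun h h' t => (wl2Equiv_equivalence G c t).trans (h t) (h' t)⟩
  refine ⟨heq, fun h => (h 0).2.1, fun {p q} h => ?_⟩
  obtain ⟨T, hT⟩ := exists_wl2Equiv_iff_wl2Stable G c
  have hcard := (h (T + 1)).2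
  simp only [hT] at hcard
  let S : Setoid (V × V) := ⟨wl2Stable G c, heq⟩
  have hS : ∀ x y : V × V, (Quotient.mk S x = Quotient.mk S y) ↔ wl2Stable G c x y :=
    fun x y => Quotient.eq
  obtain ⟨σ, hσ⟩ := exists_perm_of_card_fiber_eq
    (fun w => (Quotient.mk S (p.1, w), Quotient.mk S (w, p.2)))
    (fun w => (Quotient.mk S (q.1, w), Quotient.mk S (w, q.2))) (by
      rintro ⟨r, s⟩
      induction r using Quotient.inductionOn with | _ r => ?_
      induction s using Quotient.inductionOn with | _ s => ?_
      simpa only [Prod.mk.injEq, hS] using hcard r s)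
  refine ⟨σ, fun w => ?_⟩
  have := hσ w
  simp only [Prod.mk.injEq, hS] at this
  exact ⟨heq.symm this.1, heq.symm this.2⟩

end WeisfeilerLeman

namespace IsWLStable

variable {V : Type*} {E : V × V → V × V → Prop}

theorem fst_diag (hE : IsWLStable E) {u v u' v' : V} (h : E (u, v) (u', v')) :
    E (u, u) (u', u') := by
  obtain ⟨σ, hσ⟩ := hE.exists_perm h
  have h1 := (hσ u).1
  have h2 : u' = σ u := (hE.diag h1).1 rfl
  rwa [← h2] at h1

theorem snd_diag (hE : IsWLStable E) {u v u' v' : V} (h : E (u, v) (u', v')) :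
    E (v, v) (v', v') := by
  obtain ⟨σ, hσ⟩ := hE.exists_perm h
  have h1 := (hσ v).2
  have h2 : σ v = v' := (hE.diag h1).1 rfl
  rwa [h2] at h1

variable {D : SimpleGraph V}

theorem exists_walk (hE : IsWLStable E)
    (hD : ∀ {u v u' v'}, E (u, v) (u', v') → D.Adj u v → D.Adj u' v') {u v : V}
    (p : D.Walk u v) : ∀ {u' v' : V}, E (u, v) (u', v') →
      ∃ p' : D.Walk u' v', p'.length = p.length := by
  induction p with
  | nil =>
    intro u' v' h
    obtain rfl : u' = v' := (hE.diag h).1 rfl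
    exact ⟨.nil, rfl⟩
  | @cons a b _ hab p ih =>
    intro u' v' h
    obtain ⟨σ, hσ⟩ := hE.exists_perm h
    obtain ⟨p', hp'⟩ := ih (hσ b).2
    exact ⟨.cons (hD (hσ b).1 hab) p', by simp [hp']⟩

theorem reachable_iff (hE : IsWLStable E)
    (hD : ∀ {u v u' v'}, E (u, v) (u', v') → D.Adj u v → D.Adj u' v') {u v u' v' : V}
    (h : E (u, v) (u', v')) : D.Reachable u v ↔ D.Reachable u' v' :=
  ⟨fun ⟨p⟩ => (hE.exists_walk hD p h).nonempty, fun ⟨p⟩ =>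
    (hE.exists_walk hD p (hE.equiv.symm h)).nonempty⟩

theorem dist_eq (hE : IsWLStable E)
    (hD : ∀ {u v u' v'}, E (u, v) (u', v') → D.Adj u v → D.Adj u' v') {u v u' v' : V}
    (h : E (u, v) (u', v')) : D.dist u v = D.dist u' v' := by
  by_cases hr : D.Reachable u v
  · have hr' := (hE.reachable_iff hD h).1 hr
    obtain ⟨p, hp⟩ := hr.exists_walk_length_eq_dist
    obtain ⟨p', hp'⟩ := hr'.exists_walk_length_eq_dist
    obtain ⟨s, hs⟩ := hE.exists_walk hD p h
    obtain ⟨s', hs'⟩ := hE.exists_walk hD p' (hE.equiv.symm h)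
    have := D.dist_le s
    have := D.dist_le s'
    omega
  · rw [SimpleGraph.dist_eq_zero_of_not_reachable hr,
      SimpleGraph.dist_eq_zero_of_not_reachable (mt (hE.reachable_iff hD h).2 hr)]

open Classical in
theorem card_filter_eq [Fintype V] (hE : IsWLStable E) {P : V → V → Prop}
    (hP : ∀ {u v u' v'}, E (u, v) (u', v') → (P u v ↔ P u' v')) {z z' : V}
    (h : E (z, z) (z', z')) :
    (Finset.univ.filter fun y => P z y).card = (Finset.univ.filter fun y => P z' y).card := by
  obtain ⟨σ, hσ⟩ := hE.exists_perm h
  exact Finset.card_equiv σ fun y => by simpa using hP (hσ y).1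

end IsWLStable

section Separation

open Finset

theorem two_mul_pow_le_succ_pow {k : ℕ} (hk : 0 < k) : 2 * k ^ k ≤ (k + 1) ^ k := by
  have hk' : (0 : ℚ) < k := by exact_mod_cast hk
  have h := one_add_mul_le_pow (a := 1 / (k : ℚ)) (by linarith [one_div_pos.2 hk']) k
  have h1 : (2 : ℚ) * k ^ k ≤ (k + 1) ^ k := by
    calc (2 : ℚ) * k ^ k = (1 + k * (1 / (k : ℚ))) * k ^ k := by field_simp; norm_num
      _ ≤ (1 + 1 / (k : ℚ)) ^ k * k ^ k := by gcongr
      _ = (k + 1) ^ k := by rw [← mul_pow]; congr 1; field_simp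
  exact_mod_cast h1

open Classical in
/-- If all level sets of `g` on `B` are small, then at most half of the tuples from `B` are
constant under `g`. -/
theorem two_mul_card_const_le {V : Type*} {k : ℕ} (hk : 0 < k) (B : Finset V) (g : V → ℕ)
    (hg : ∀ j, (k + 1) * (B.filter fun y => g y = j).card ≤ k * B.card) :
    2 * ((Fintype.piFinset fun _ : Fin (k + 1) => B).filter
      fun w => ∀ i j, g (w i) = g (w j)).card ≤ B.card ^ (k + 1) := by
  have hsub : ((Fintype.piFinset fun _ : Fin (k + 1) => B).filter
      fun w => ∀ i j, g (w i) = g (w j)) ⊆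
      B.biUnion fun y => (Fintype.piFinset fun _ : Fin k => B.filter fun x => g x = g y).image
        fun w => (Fin.cons y w : Fin (k + 1) → V) := by
    intro w hw
    simp only [mem_filter, Fintype.mem_piFinset] at hw
    simp only [mem_biUnion, mem_image, Fintype.mem_piFinset, mem_filter]
    exact ⟨w 0, hw.1 0, Fin.tail w, fun i => ⟨hw.1 _, hw.2 _ _⟩, Fin.cons_self_tail w⟩
  have hpow : ∀ y ∈ B, 2 * (B.filter fun x => g x = g y).card ^ k ≤ B.card ^ k := by
    intro y _
    have h1 := Nat.pow_le_pow_left (hg (g y)) k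
    rw [mul_pow, mul_pow] at h1
    have h3 : 0 < k ^ k := by positivity
    have h4 := Nat.mul_le_mul_right ((B.filter fun x => g x = g y).card ^ k)
      (two_mul_pow_le_succ_pow hk)
    refine Nat.le_of_mul_le_mul_left ?_ h3
    calc _ = 2 * k ^ k * (B.filter fun x => g x = g y).card ^ k := by ring
      _ ≤ _ := h4.trans h1
  calc _ ≤ 2 * ∑ y ∈ B, (B.filter fun x => g x = g y).card ^ k := by
        refine Nat.mul_le_mul_left _ ((card_le_card hsub).trans (card_biUnion_le.trans ?_))
        refine sum_le_sum fun y _ => card_image_le.trans ?_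
        simp
    _ ≤ ∑ _y ∈ B, B.card ^ k := by
        rw [mul_sum]
        exact sum_le_sum hpow
    _ = B.card ^ (k + 1) := by rw [sum_const, smul_eq_mul, pow_succ, mul_comm]

open Classical in
theorem exists_tuple_separated {U V : Type*} {k : ℕ} (hk : 0 < k) (A : Finset U) (B : Finset V)
    (hB : B.Nonempty) (d : U → V → ℕ)
    (hd : ∀ z ∈ A, ∀ j, (k + 1) * (B.filter fun y => d z y = j).card ≤ k * B.card) :
    ∃ w : Fin (k + 1) → V, (∀ i, w i ∈ B) ∧
      A.card ≤ 2 * (A.filter fun z => ∃ i j, d z (w i) ≠ d z (w j)).card := by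
  have hsum : ∑ w ∈ Fintype.piFinset fun _ : Fin (k + 1) => B,
      2 * (A.filter fun z => ∀ i j, d z (w i) = d z (w j)).card ≤
      ∑ _w ∈ Fintype.piFinset fun _ : Fin (k + 1) => B, A.card := by
    have hswap := sum_card_bipartiteAbove_eq_sum_card_bipartiteBelow
      (s := Fintype.piFinset fun _ : Fin (k + 1) => B) (t := A)
      (fun (w : Fin (k + 1) → V) z => ∀ i j, d z (w i) = d z (w j))
    simp only [bipartiteAbove, bipartiteBelow] at hswap
    rw [← mul_sum, hswap, mul_sum]
    calc _ ≤ ∑ _z ∈ A, B.card ^ (k + 1) := sum_le_sum fun z hz =>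
          two_mul_card_const_le hk B (d z) (hd z hz)
      _ = _ := by simp [mul_comm]
  obtain ⟨w, hw, h⟩ := exists_le_of_sum_le (by simpa using hB) hsum
  refine ⟨w, by simpa using hw, ?_⟩
  have := card_filter_add_card_filter_not (s := A) (fun z => ∀ i j, d z (w i) = d z (w j))
  simp only [not_forall] at this
  simp only [ne_eq]
  omega

open Classical in
/-- The vertices which are not equidistant from all entries of the tuple `w`. -/
noncomputable def separators {V ι : Type*} [Fintype V] (D : SimpleGraph V) (w : ι → V) : Finset V :=
  univ.filter fun v => ∃ i j, D.dist v (w i) ≠ D.dist v (w j)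

open Classical in
theorem exists_separators_large {V : Type*} [Fintype V] {E : V × V → V × V → Prop}
    (hE : IsWLStable E) {D : SimpleGraph V}
    (hD : ∀ {u v u' v'}, E (u, v) (u', v') → D.Adj u v → D.Adj u' v') {Δ : ℕ} (hΔ : 0 < Δ)
    (hdeg : ∀ v, (univ.filter fun u => D.Adj v u).card ≤ Δ) (z₀ : V)
    (h2 : 2 ≤ (univ.filter fun z => E (z, z) (z₀, z₀) ∧ D.Reachable z₀ z).card) :
    ∃ y₀, ∃ w : Fin (Δ + 1) → V, (∀ i, E (w i, w i) (y₀, y₀) ∧ D.Reachable y₀ (w i)) ∧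
      (univ.filter fun z => E (z, z) (z₀, z₀) ∧ D.Reachable z₀ z).card ≤
        2 * (separators D w).card := by
  by_contra! hcon
  set A := univ.filter fun z => E (z, z) (z₀, z₀) ∧ D.Reachable z₀ z with hA
  have hmemA : ∀ z, z ∈ A ↔ E (z, z) (z₀, z₀) ∧ D.Reachable z₀ z := by simp [hA]
  -- distances to any vertex of the component concentrate on one value
  have hconc : ∀ y, D.Reachable z₀ y →
      ∃ j, Δ * A.card < (Δ + 1) * (A.filter fun z => D.dist y z = j).card := by
    intro y hy
    set B := univ.filter fun x => E (x, x) (y, y) ∧ D.Reachable y x with hB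
    have hmemB : ∀ x, x ∈ B ↔ E (x, x) (y, y) ∧ D.Reachable y x := by simp [hB]
    have hyB : y ∈ B := (hmemB y).2 ⟨hE.equiv.refl _, .refl _⟩
    obtain ⟨z, hz, j, hj⟩ : ∃ z ∈ A, ∃ j,
        Δ * B.card < (Δ + 1) * (B.filter fun x => D.dist z x = j).card := by
      by_contra! h
      obtain ⟨w, hw, hw'⟩ := exists_tuple_separated hΔ A B ⟨y, hyB⟩ D.dist h
      refine (hcon y w fun i => (hmemB _).1 (hw i)).not_ge (hw'.trans ?_)
      exact Nat.mul_le_mul_left _ (card_le_card fun z hz => by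
        simpa [separators] using (mem_filter.1 hz).2)
    refine ⟨j, ?_⟩
    have hregA : ∀ z' ∈ A, (B.filter fun x => D.dist z' x = j).card =
        (B.filter fun x => D.dist z x = j).card := by
      intro z' hz'
      have := hE.card_filter_eq
        (P := fun u x => (E (x, x) (y, y) ∧ D.Reachable u x) ∧ D.dist u x = j)
        (z := z') (z' := z) (fun {u v u' v'} h => by
          rw [hE.reachable_iff hD h, hE.dist_eq hD h]
          have := hE.snd_diag h
          have : E (v, v) (y, y) ↔ E (v', v') (y, y) :=
            ⟨hE.equiv.trans (hE.equiv.symm this), hE.equiv.trans this⟩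
          rw [this]) (hE.equiv.trans ((hmemA _).1 hz').1 (hE.equiv.symm ((hmemA _).1 hz).1))
      have hr : ∀ u ∈ A, ∀ x, D.Reachable u x ↔ D.Reachable y x := fun u hu x => by
        have := ((hmemA _).1 hu).2
        exact ⟨fun h => (hy.symm.trans this).trans h, fun h => (this.symm.trans hy).trans h⟩
      simpa only [hB, filter_filter, hr z hz, hr z' hz'] using this
    have hregB : ∀ x ∈ B, (A.filter fun z => D.dist z x = j).card =
        (A.filter fun z => D.dist z y = j).card := by
      intro x hx
      have := hE.card_filter_eq
        (P := fun u v => (E (v, v) (z₀, z₀) ∧ D.Reachable u v) ∧ D.dist u v = j)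
        (z := x) (z' := y) (fun {u v u' v'} h => by
          rw [hE.reachable_iff hD h, hE.dist_eq hD h]
          have := hE.snd_diag h
          have : E (v, v) (z₀, z₀) ↔ E (v', v') (z₀, z₀) :=
            ⟨hE.equiv.trans (hE.equiv.symm this), hE.equiv.trans this⟩
          rw [this]) ((hmemB _).1 hx).1
      have hr : ∀ v, D.Reachable y v ↔ D.Reachable z₀ v := fun v =>
        ⟨hy.trans, hy.symm.trans⟩
      have hr' : ∀ v, D.Reachable x v ↔ D.Reachable z₀ v := fun v => by
        have := ((hmemB _).1 hx).2
        exact ⟨(hy.trans this).trans, (hy.trans this).symm.trans⟩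
      simp only [D.dist_comm (v := x), D.dist_comm (v := y)]
      simpa only [hA, filter_filter, hr, hr'] using this
    have hdc := card_mul_eq_card_mul (fun z x => D.dist z x = j) hregA hregB
    have hBpos : 0 < B.card := card_pos.2 ⟨y, hyB⟩
    simp only [D.dist_comm (u := y)]
    refine Nat.lt_of_mul_lt_mul_left (a := B.card) ?_
    have hApos : 0 < A.card := by omega
    calc B.card * (Δ * A.card) = A.card * (Δ * B.card) := by ring
      _ < A.card * ((Δ + 1) * (B.filter fun x => D.dist z x = j).card) :=
        Nat.mul_lt_mul_of_pos_left hj hApos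
      _ = (Δ + 1) * (A.card * (B.filter fun x => D.dist z x = j).card) := by ring
      _ = _ := by rw [hdc]; ring
  have hnone : ∀ j y, D.Reachable z₀ y →
      (Δ + 1) * (A.filter fun z => D.dist y z = j).card ≤ Δ * A.card := by
    intro j
    induction j with
    | zero =>
      intro y hy
      have h1 : (A.filter fun z => D.dist y z = 0).card ≤ 1 := by
        refine card_le_one.2 fun a ha b hb => ?_
        simp only [mem_filter, hmemA] at ha hb
        rw [← (hy.symm.trans ha.1.2).dist_eq_zero_iff.1 ha.2,
          ← (hy.symm.trans hb.1.2).dist_eq_zero_iff.1 hb.2]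
      nlinarith
    | succ j ih =>
      intro y hy
      by_contra! hlt
      have hsub : (A.filter fun z => D.dist y z = j + 1) ⊆
          (univ.filter fun u => D.Adj y u).biUnion fun u => A.filter fun z => D.dist u z = j := by
        intro z hz
        simp only [mem_filter] at hz
        obtain ⟨p, hp⟩ := (hy.symm.trans ((hmemA z).1 hz.1).2).exists_walk_length_eq_dist
        cases p with
        | nil =>
          rw [SimpleGraph.Walk.length_nil, hz.2] at hp
          omega
        | @cons _ u _ huv p =>
          simp only [mem_biUnion, mem_filter, mem_univ, true_and]
          refine ⟨u, huv, hz.1, ?_⟩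
          have h1 := D.dist_le p
          obtain ⟨p', hp'⟩ := p.reachable.exists_walk_length_eq_dist
          have h2 := D.dist_le (SimpleGraph.Walk.cons huv p')
          simp only [SimpleGraph.Walk.length_cons] at hp h2
          omega
      obtain ⟨u, hu, hub⟩ : ∃ u, D.Adj y u ∧ A.card <
          (Δ + 1) * (A.filter fun z => D.dist u z = j).card := by
        by_contra! h
        have h1 : (A.filter fun z => D.dist y z = j + 1).card ≤
            ∑ u ∈ univ.filter fun u => D.Adj y u, (A.filter fun z => D.dist u z = j).card :=
          (card_le_card hsub).trans card_biUnion_le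
        have h3 : (Δ + 1) * ∑ u ∈ univ.filter fun u => D.Adj y u,
            (A.filter fun z => D.dist u z = j).card ≤ Δ * A.card := by
          rw [mul_sum]
          refine (sum_le_card_nsmul _ _ A.card fun u hu => h u (by simpa using hu)).trans ?_
          rw [smul_eq_mul]
          exact Nat.mul_le_mul_right _ (hdeg y)
        exact hlt.not_ge ((Nat.mul_le_mul_left _ h1).trans h3)
      have hru := hy.trans hu.reachable
      obtain ⟨i, hi⟩ := hconc u hru
      have hij : i ≠ j := by
        rintro rfl
        exact hi.not_ge (ih u hru)
      have hdisj : Disjoint (A.filter fun z => D.dist u z = i)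
          (A.filter fun z => D.dist u z = j) :=
        disjoint_filter.2 fun z _ h h' => hij (h.symm.trans h')
      have hle := card_le_card (union_subset (filter_subset (fun z => D.dist u z = i) A)
        (filter_subset (fun z => D.dist u z = j) A))
      rw [card_union_of_disjoint hdisj] at hle
      nlinarith
  obtain ⟨j, hj⟩ := hconc z₀ (.refl _)
  exact hj.not_ge (hnone j z₀ (.refl _))

end Separation

section Disparity

variable {V : Type*}

theorem majority_comm (H : SimpleGraph V) (r : V → V → Prop) (u v : V) :
    majority H r u v ↔ majority H r v u := by
  have h1 : Nat.card {p : V × V // p.1 ≠ p.2 ∧ r p.1 u ∧ r p.2 v} =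
      Nat.card {p : V × V // p.1 ≠ p.2 ∧ r p.1 v ∧ r p.2 u} :=
    Nat.card_congr ((Equiv.prodComm V V).subtypeEquiv fun p => by simp; tauto)
  have h2 : Nat.card {p : V × V // p.1 ≠ p.2 ∧ r p.1 u ∧ r p.2 v ∧ H.Adj p.1 p.2} =
      Nat.card {p : V × V // p.1 ≠ p.2 ∧ r p.1 v ∧ r p.2 u ∧ H.Adj p.1 p.2} :=
    Nat.card_congr ((Equiv.prodComm V V).subtypeEquiv fun p => by
      simp [H.adj_comm p.1 p.2]; tauto)
  rw [majority, majority, h1, h2]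

theorem disparity_adj (H : SimpleGraph V) (r : V → V → Prop) (u v : V) :
    (disparity H r).Adj u v ↔ u ≠ v ∧ ¬(H.Adj u v ↔ majority H r u v) := by
  rw [disparity, SimpleGraph.fromRel_adj, majority_comm H r v u, H.adj_comm v u, or_self]
  exact and_congr_right fun _ => xor_iff_not_iff _ _

theorem majority_congr {Ω : Type*} (H : SimpleGraph V) {c : V → Ω} {u v u' v' : V}
    (hu : c u = c u') (hv : c v = c v') :
    majority H (fun x y => c x = c y) u v ↔ majority H (fun x y => c x = c y) u' v' := by
  simp only [majority, hu, hv]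

theorem refineColor_eq {Ω : Type*} {c : V → Ω} {f : V → Bool} {u v : V}
    (h : refineColor c f u = refineColor c f v) : c u = c v := by
  unfold refineColor at h
  split_ifs at h with h1 h2
  · rw [Sum.inr.inj h]
  · exact Sum.inl.inj h

theorem refineColor_eq_of_true {Ω : Type*} {c : V → Ω} {f : V → Bool} {u v : V}
    (hu : f u = true) (h : refineColor c f u = refineColor c f v) : u = v := by
  unfold refineColor at h
  split_ifs at h with h1
  exact Sum.inr.inj h

variable {Ω : Type*} {H : SimpleGraph V} {c : V → Ω} {f : V → Bool}

theorem wl2Stable.color_eq {u v : V} (h : wl2Stable H (refineColor c f) (u, u) (v, v)) :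
    refineColor c f u = refineColor c f v := (h 0).2.2 rfl rfl

theorem wl2Stable.disparity_adj [Finite V] {u v u' v' : V}
    (h : wl2Stable H (refineColor c f) (u, v) (u', v'))
    (hD : (disparity H fun x y => c x = c y).Adj u v) :
    (disparity H fun x y => c x = c y).Adj u' v' := by
  have hE := isWLStable_wl2Stable H (refineColor c f)
  have hu := refineColor_eq (hE.fst_diag h).color_eq
  have hv := refineColor_eq (hE.snd_diag h).color_eq
  rw [_root_.disparity_adj] at hD ⊢
  rw [← majority_congr H hu hv, ← (h 0).1]
  exact ⟨fun e => hD.1 ((hE.diag h).2 e), hD.2⟩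

theorem dist_eq_of_individualised [Finite V] {u v x : V}
    (h : wl2Stable H (refineColor c f) (u, u) (v, v)) (hx : f x = true) :
    (disparity H fun x y => c x = c y).dist x u = (disparity H fun x y => c x = c y).dist x v := by
  have hE := isWLStable_wl2Stable H (refineColor c f)
  obtain ⟨σ, hσ⟩ := hE.exists_perm h
  have h1 := (hσ x).2
  rw [← refineColor_eq_of_true hx (hE.fst_diag h1).color_eq] at h1
  exact hE.dist_eq wl2Stable.disparity_adj h1

open Finset Classical in
theorem IsWLStable.card_pairs [Fintype V] {E : V × V → V × V → Prop} (hE : IsWLStable E)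
    {R : V → V → Prop} (hR : ∀ {u v u' v'}, E (u, v) (u', v') → (R u v ↔ R u' v')) (u : V) :
    (univ.filter fun p : V × V => E (p.1, p.1) (u, u) ∧ R p.1 p.2).card =
      (univ.filter fun x => E (x, x) (u, u)).card * (univ.filter fun y => R u y).card := by
  rw [card_filter, Fintype.sum_prod_type, ← smul_eq_mul, ← sum_const, sum_filter]
  refine sum_congr rfl fun x _ => ?_
  split_ifs with hx
  · rw [← hE.card_filter_eq hR hx, card_filter]
    simp [hx]
  · simp [hx]

open Finset Classical in
/-- If passing to the stable colouring flips the majority between the classes of `u` and `v`, then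
`u` is adjacent in the old disparity graph to at least half of the class of `v`. -/
theorem card_class_le_of_majority_ne [Fintype V] {u v : V}
    (hne : ¬(majority H (wl2VertexEquiv H (refineColor c f)) u v ↔
      majority H (fun x y => c x = c y) u v)) :
    (univ.filter fun y => u ≠ y ∧ wl2VertexEquiv H (refineColor c f) y v).card ≤
      2 * (univ.filter fun y => (u ≠ y ∧ wl2VertexEquiv H (refineColor c f) y v) ∧
        (disparity H fun x y => c x = c y).Adj u y).card := by
  set E := wl2Stable H (refineColor c f) with hEdef
  have hE : IsWLStable E := isWLStable_wl2Stable H (refineColor c f)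
  have hr : ∀ x y, wl2VertexEquiv H (refineColor c f) x y ↔ E (x, x) (y, y) := fun _ _ => Iff.rfl
  set D := disparity H fun x y => c x = c y with hDdef
  have hR1 : ∀ {a b a' b'}, E (a, b) (a', b') →
      ((a ≠ b ∧ E (b, b) (v, v)) ↔ (a' ≠ b' ∧ E (b', b') (v, v))) := fun {a b a' b'} h => by
    have h1 := hE.snd_diag h
    have h2 : E (b, b) (v, v) ↔ E (b', b') (v, v) :=
      ⟨hE.equiv.trans (hE.equiv.symm h1), hE.equiv.trans h1⟩
    rw [h2, ne_eq, (hE.diag h : a = b ↔ a' = b')]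
  have hR2 : ∀ {a b a' b'}, E (a, b) (a', b') →
      (((a ≠ b ∧ E (b, b) (v, v)) ∧ D.Adj a b) ↔ ((a' ≠ b' ∧ E (b', b') (v, v)) ∧ D.Adj a' b')) :=
    fun {a b a' b'} h => by
      rw [hR1 h]
      exact and_congr_right fun _ => ⟨wl2Stable.disparity_adj h,
        wl2Stable.disparity_adj (hE.equiv.symm h)⟩
  have hc1 := hE.card_pairs hR1 u
  have hc2 := hE.card_pairs hR2 u
  have hmaj : ∀ p : V × V, E (p.1, p.1) (u, u) → E (p.2, p.2) (v, v) → p.1 ≠ p.2 →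
      (D.Adj p.1 p.2 ↔ ¬(H.Adj p.1 p.2 ↔ majority H (fun x y => c x = c y) u v)) :=
    fun p h1 h2 h3 => by
      rw [hDdef, disparity_adj, majority_congr H (refineColor_eq h1.color_eq)
        (refineColor_eq h2.color_eq), and_iff_right h3]
  have hle : (univ.filter fun p : V × V => E (p.1, p.1) (u, u) ∧ p.1 ≠ p.2 ∧
      E (p.2, p.2) (v, v)).card ≤ 2 * (univ.filter fun p : V × V => E (p.1, p.1) (u, u) ∧
        (p.1 ≠ p.2 ∧ E (p.2, p.2) (v, v)) ∧ D.Adj p.1 p.2).card := by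
    set P := univ.filter fun p : V × V => E (p.1, p.1) (u, u) ∧ p.1 ≠ p.2 ∧ E (p.2, p.2) (v, v)
      with hP
    have hPmem : ∀ p, p ∈ P ↔ E (p.1, p.1) (u, u) ∧ p.1 ≠ p.2 ∧ E (p.2, p.2) (v, v) := by
      simp [hP]
    have hPD : (univ.filter fun p : V × V => E (p.1, p.1) (u, u) ∧
        (p.1 ≠ p.2 ∧ E (p.2, p.2) (v, v)) ∧ D.Adj p.1 p.2) = P.filter fun p => D.Adj p.1 p.2 := by
      ext p
      simp only [mem_filter, mem_univ, true_and, hPmem]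
      tauto
    have hmf : majority H (wl2VertexEquiv H (refineColor c f)) u v ↔
        P.card ≤ 2 * (P.filter fun p => H.Adj p.1 p.2).card := by
      rw [majority, Nat.card_eq_fintype_card, Nat.card_eq_fintype_card, Fintype.card_subtype,
        Fintype.card_subtype]
      have h1 : (univ.filter fun p : V × V => p.1 ≠ p.2 ∧
          wl2VertexEquiv H (refineColor c f) p.1 u ∧
          wl2VertexEquiv H (refineColor c f) p.2 v) = P := by
        ext p
        simp only [mem_filter, mem_univ, true_and, hPmem, hr]
        tauto
      have h2 : (univ.filter fun p : V × V => p.1 ≠ p.2 ∧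
          wl2VertexEquiv H (refineColor c f) p.1 u ∧
          wl2VertexEquiv H (refineColor c f) p.2 v ∧ H.Adj p.1 p.2) =
          P.filter fun p => H.Adj p.1 p.2 := by
        ext p
        simp only [mem_filter, mem_univ, true_and, hPmem, hr]
        tauto
      rw [h1, h2]
    rw [hPD]
    rw [hmf] at hne
    have hsplit := card_filter_add_card_filter_not (s := P) (fun p => H.Adj p.1 p.2)
    by_cases hm : majority H (fun x y => c x = c y) u v
    · have : (P.filter fun p => D.Adj p.1 p.2) = P.filter fun p => ¬H.Adj p.1 p.2 :=
        filter_congr fun p hp => by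
          obtain ⟨h1, h2, h3⟩ := (hPmem p).1 hp
          simp [hmaj p h1 h3 h2, hm]
      rw [this]
      simp only [hm, iff_true] at hne
      omega
    · have : (P.filter fun p => D.Adj p.1 p.2) = P.filter fun p => H.Adj p.1 p.2 :=
        filter_congr fun p hp => by
          obtain ⟨h1, h2, h3⟩ := (hPmem p).1 hp
          simp [hmaj p h1 h3 h2, hm]
      rw [this]
      simp only [hm, iff_false, not_not] at hne
      exact hne
  have hpos : 0 < (univ.filter fun x => E (x, x) (u, u)).card :=
    card_pos.2 ⟨u, by simpa using hE.equiv.refl _⟩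
  have hmul := (hc1.symm.trans (by congr!)).trans_le
    (hle.trans_eq (congrArg (2 * ·) (Eq.trans (by congr!) hc2)))
  have := Nat.le_of_mul_le_mul_left (hmul.trans_eq (Nat.mul_left_comm _ _ _)) hpos
  convert this <;> exact hr _ _

open Finset Classical in
theorem reachable_or_reachable_of_adj [Fintype V] {u v x : V}
    (hadj : (disparity H (wl2VertexEquiv H (refineColor c f))).Adj u v)
    (hnr : ¬(disparity H fun x y => c x = c y).Reachable u v)
    (hx : wl2VertexEquiv H (refineColor c f) x u) :
    (disparity H fun x y => c x = c y).Reachable u x ∨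
      (disparity H fun x y => c x = c y).Reachable v x := by
  have hE := isWLStable_wl2Stable H (refineColor c f)
  set D := disparity H fun x y => c x = c y with hDdef
  by_contra! hcon
  obtain ⟨hux, hvx⟩ := hcon
  rw [disparity_adj] at hadj
  obtain ⟨huv, hadj⟩ := hadj
  have hnadj : ¬D.Adj u v := fun h => hnr h.reachable
  have hne : ¬(majority H (wl2VertexEquiv H (refineColor c f)) u v ↔
      majority H (fun x y => c x = c y) u v) := by
    rw [hDdef, disparity_adj] at hnadj
    tauto
  have hu := card_class_le_of_majority_ne hne
  set r := wl2VertexEquiv H (refineColor c f) with hrdef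
  set K := univ.filter fun y => r y v with hK
  set Nu := univ.filter fun y => (u ≠ y ∧ r y v) ∧ D.Adj u y with hNu
  set Nx := univ.filter fun y => (x ≠ y ∧ r y v) ∧ D.Adj x y with hNx
  have hcard : Nx.card = Nu.card := by
    convert hE.card_filter_eq (z := x) (z' := u)
      (P := fun a b => (a ≠ b ∧ r b v) ∧ D.Adj a b)
      (fun {a b a' b'} h => by
        have h1 := hE.snd_diag h
        have h2 : r b v ↔
          r b' v :=
        ⟨hE.equiv.trans (hE.equiv.symm h1), hE.equiv.trans h1⟩
        have h3 : D.Adj a b ↔ D.Adj a' b' := ⟨wl2Stable.disparity_adj h,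
          wl2Stable.disparity_adj (hE.equiv.symm h)⟩
        rw [h2, h3, ne_eq, (hE.diag h : a = b ↔ a' = b')]) hx
  have hdisj : Disjoint Nu Nx := by
    refine disjoint_filter.2 fun y _ h h' => hux ?_
    exact h.2.reachable.trans h'.2.reachable.symm
  have hUeq : (univ.filter fun y => u ≠ y ∧ r y v) = K.erase u := by
    ext y
    simp [hK, eq_comm]
  rw [hUeq] at hu
  have hvK : v ∈ K := by
    simp only [hK, mem_filter, mem_univ, true_and]
    exact hE.equiv.refl _
  have hsub : Nu ∪ Nx ⊆ (K.erase u).erase v := by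
    intro y hy
    simp only [hNu, hNx, hK, mem_union, mem_filter, mem_univ, true_and, mem_erase] at hy ⊢
    rcases hy with hy | hy
    · exact ⟨fun h => hnadj (h ▸ hy.2), hy.1.1.symm, hy.1.2⟩
    · exact ⟨fun h => hvx (h ▸ hy.2.reachable.symm), fun h => hux (h ▸ hy.2.reachable.symm), hy.1.2⟩
  have hle := card_le_card hsub
  rw [card_union_of_disjoint hdisj, card_erase_of_mem (mem_erase.2 ⟨huv.symm, hvK⟩)] at hle
  have hpos : 0 < (K.erase u).card := card_pos.2 ⟨v, mem_erase.2 ⟨huv.symm, hvK⟩⟩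
  omega

open Finset Classical in
theorem exists_large_class [Fintype V] {s' : ℕ}
    (h : ¬sBounded H (wl2VertexEquiv H (refineColor c f)) s') :
    ∃ z₀, s' < 2 * (univ.filter fun z => wl2Stable H (refineColor c f) (z, z) (z₀, z₀) ∧
      (disparity H fun x y => c x = c y).Reachable z₀ z).card := by
  have hE := isWLStable_wl2Stable H (refineColor c f)
  set E := wl2Stable H (refineColor c f) with hEdef
  have hr : ∀ x y, wl2VertexEquiv H (refineColor c f) x y ↔ E (x, x) (y, y) := fun _ _ => Iff.rfl
  set D := disparity H fun x y => c x = c y with hDdef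
  set D' := disparity H (wl2VertexEquiv H (refineColor c f)) with hD'
  obtain ⟨u, v, huv⟩ : ∃ u v, s' <
      Nat.card {w : V // wl2VertexEquiv H (refineColor c f) w u ∧ w ∈ compSet D' v} := by
    simpa [sBounded] using h
  rw [Nat.card_eq_fintype_card, Fintype.card_subtype] at huv
  set S := univ.filter fun w => wl2VertexEquiv H (refineColor c f) w u ∧ w ∈ compSet D' v with hS
  have hSmem : ∀ w, w ∈ S ↔ E (w, w) (u, u) ∧ D'.Reachable v w := by
    intro w
    simp [hS, compSet, hr]
  obtain ⟨z₀, hz₀⟩ := card_pos.1 (Nat.zero_lt_of_lt huv)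
  have hz₀' := (hSmem z₀).1 hz₀
  have hSz : ∀ w ∈ S, E (w, w) (z₀, z₀) ∧ D'.Reachable z₀ w := fun w hw => by
    have := (hSmem w).1 hw
    exact ⟨hE.equiv.trans this.1 (hE.equiv.symm hz₀'.1), hz₀'.2.symm.trans this.2⟩
  by_cases hclosed : ∀ a b, D.Reachable z₀ a → D'.Adj a b → D.Reachable z₀ b
  · have hreach : ∀ w, D'.Reachable z₀ w → D.Reachable z₀ w := by
      intro w hw
      rw [SimpleGraph.reachable_iff_reflTransGen] at hw
      induction hw with
      | refl => exact .refl _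
      | tail _ hab ih => exact hclosed _ _ ih hab
    refine ⟨z₀, ?_⟩
    refine huv.trans_le ((card_le_card fun w hw => mem_filter.2 ?_).trans
      (Nat.le_mul_of_pos_left _ two_pos))
    exact ⟨mem_univ w, (hSz w hw).1, hreach w (hSz w hw).2⟩
  · push Not at hclosed
    obtain ⟨a, b, ha, hab, hb⟩ := hclosed
    have hcover : ∀ z, E (z, z) (z₀, z₀) → D.Reachable z₀ z ∨ D.Reachable b z := by
      intro z hz
      obtain ⟨σ, hσ⟩ := hE.exists_perm (hE.equiv.symm hz)
      have h1 := (hσ a).1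
      have h2 : D.Reachable z (σ a) := (hE.reachable_iff wl2Stable.disparity_adj h1).1 ha
      rcases reachable_or_reachable_of_adj hab (fun h => hb (ha.trans h))
        (hE.equiv.symm (hE.snd_diag h1)) with h3 | h3
      · exact .inl ((ha.trans h3).trans h2.symm)
      · exact .inr (h3.trans h2.symm)
    set A := univ.filter fun z => E (z, z) (z₀, z₀) ∧ D.Reachable z₀ z with hA
    set B := univ.filter fun z => E (z, z) (z₀, z₀) ∧ D.Reachable b z with hB
    have hle : S.card ≤ A.card + B.card := by
      refine (card_le_card fun w hw => ?_).trans (card_union_le A B)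
      have := (hSz w hw).1
      simp only [hA, hB, mem_union, mem_filter, mem_univ, true_and, this]
      exact hcover w this
    rcases le_total B.card A.card with hBA | hAB
    · refine ⟨z₀, (show s' < 2 * A.card by omega).trans_eq ?_⟩
      congr!
    · obtain ⟨z₁, hz₁⟩ : B.Nonempty := card_pos.1 (by omega)
      simp only [hB, mem_filter, mem_univ, true_and] at hz₁
      refine ⟨z₁, ?_⟩
      have : B ⊆ univ.filter fun z => E (z, z) (z₁, z₁) ∧ D.Reachable z₁ z := by
        intro z hz
        simp only [hB, mem_filter, mem_univ, true_and] at hz ⊢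
        exact ⟨hE.equiv.trans hz.1 (hE.equiv.symm hz₁.1), hz₁.2.symm.trans hz.2⟩
      have := card_le_card this
      omega

open Finset Classical in
theorem exists_separators_not_individualised [Fintype V] {s' Δ : ℕ} (hs' : 2 ≤ s') (hΔ : 0 < Δ)
    (hdeg : ∀ v : V, Nat.card {u : V // (disparity H fun x y => c x = c y).Adj v u} ≤ Δ)
    (h : ¬sBounded H (wl2VertexEquiv H (refineColor c f)) s') :
    ∃ y₀, ∃ w : Fin (Δ + 1) → V,
      (∀ i, c (w i) = c y₀ ∧ (disparity H fun x y => c x = c y).Reachable y₀ (w i)) ∧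
      s' < 4 * (separators (disparity H fun x y => c x = c y) w).card ∧
      ∀ v ∈ separators (disparity H fun x y => c x = c y) w, f v = false := by
  have hE := isWLStable_wl2Stable H (refineColor c f)
  obtain ⟨z₀, hz₀⟩ := exists_large_class h
  obtain ⟨y₀, w, hw, hcard⟩ := exists_separators_large hE wl2Stable.disparity_adj hΔ
    (fun v => by simpa [Nat.card_eq_fintype_card, Fintype.card_subtype] using hdeg v) z₀ (by omega)
  refine ⟨y₀, w, fun i => ⟨refineColor_eq (hw i).1.color_eq, (hw i).2⟩, by omega, fun v hv => ?_⟩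
  simp only [separators, mem_filter, mem_univ, true_and] at hv
  obtain ⟨i, j, hij⟩ := hv
  by_contra hf
  exact hij (dist_eq_of_individualised (hE.equiv.trans (hw i).1 (hE.equiv.symm (hw j).1))
    (by simpa using hf))

end Disparity

section Probability

open Finset

variable {ι : Type*} [Fintype ι] [DecidableEq ι]

theorem bernoulliProduct_cylinder {q : ι → ℝ} (hq : ∀ i, 0 ≤ q i ∧ q i ≤ 1) (T : Finset ι) :
    bernoulliProduct ι q {f | ∀ v ∈ T, f v = false} = ∏ v ∈ T, ENNReal.ofReal (1 - q v) := by
  have hsum : bernoulliProduct ι q {f | ∀ v ∈ T, f v = false} =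
      ∑ f ∈ Fintype.piFinset fun v => if v ∈ T then {false} else univ,
        ∏ i, if f i then ENNReal.ofReal (q i) else ENNReal.ofReal (1 - q i) := by
    rw [bernoulliProduct, Measure.coe_finsetSum, Finset.sum_apply]
    simp only [Measure.smul_apply, Measure.dirac_apply, smul_eq_mul]
    rw [← sum_subset (subset_univ (Fintype.piFinset fun v => if v ∈ T then {false} else univ))]
    · refine sum_congr rfl fun f hf => ?_
      rw [Set.indicator_of_mem, Pi.one_apply, mul_one]
      intro v hv
      simpa [hv] using Fintype.mem_piFinset.1 hf v
    · intro f _ hf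
      rw [Set.indicator_of_notMem, mul_zero]
      refine fun h => hf (Fintype.mem_piFinset.2 fun v => ?_)
      split_ifs with hv
      · simpa using h v hv
      · exact mem_univ _
  rw [hsum, ← prod_univ_sum (fun v => if v ∈ T then {false} else univ)
    (fun i b => if b then ENNReal.ofReal (q i) else ENNReal.ofReal (1 - q i)),
    ← prod_subset (subset_univ T)]
  · exact prod_congr rfl fun v hv => by simp [hv]
  · intro v _ hv
    simp only [hv, if_false, Fintype.sum_bool, if_true, Bool.false_eq_true]
    rw [← ENNReal.ofReal_add (hq v).1 (by linarith [(hq v).2])]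
    simp

theorem isProbabilityMeasure_bernoulliProduct {q : ι → ℝ} (hq : ∀ i, 0 ≤ q i ∧ q i ≤ 1) :
    IsProbabilityMeasure (bernoulliProduct ι q) :=
  ⟨by simpa using bernoulliProduct_cylinder hq ∅⟩

theorem bernoulliProduct_cylinder_le {q : ι → ℝ} (hq : ∀ i, 0.7 ≤ q i ∧ q i ≤ 1) (T : Finset ι) :
    bernoulliProduct ι q {f | ∀ v ∈ T, f v = false} ≤ ENNReal.ofReal (Real.exp (-T.card)) := by
  have hexp : (0.3 : ℝ) ≤ Real.exp (-1) := by
    have := Real.exp_neg_one_gt_d9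
    linarith
  rw [bernoulliProduct_cylinder fun i => ⟨by linarith [(hq i).1], (hq i).2⟩]
  calc _ ≤ ∏ _v ∈ T, ENNReal.ofReal (Real.exp (-1)) :=
        prod_le_prod' fun v _ => ENNReal.ofReal_le_ofReal (by linarith [(hq v).1])
    _ = _ := by
        rw [prod_const, ← ENNReal.ofReal_pow (Real.exp_pos _).le, ← Real.exp_nat_mul]
        simp

open Classical in
theorem bernoulliProduct_not_sBounded_le {Ω : Type*} {H : SimpleGraph ι} {c : ι → Ω} {s s' Δ : ℕ}
    (hs' : 2 ≤ s') (hΔ : 0 < Δ) (hbdd : sBounded H (fun x y => c x = c y) s)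
    (hdeg : ∀ v : ι, Nat.card {u : ι // (disparity H fun x y => c x = c y).Adj v u} ≤ Δ)
    {q : ι → ℝ} (hq : ∀ i, 0.7 ≤ q i ∧ q i ≤ 1) :
    bernoulliProduct ι q {f | ¬sBounded H (wl2VertexEquiv H (refineColor c f)) s'} ≤
      ENNReal.ofReal (Fintype.card ι * (s : ℝ) ^ (Δ + 1) * Real.exp (-(s' / 4 : ℝ))) := by
  set D := disparity H fun x y => c x = c y with hD
  set Q : ι → Finset ι := fun y => univ.filter fun x => c x = c y ∧ D.Reachable y x with hQ
  have hQs : ∀ y, (Q y).card ≤ s := fun y => by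
    have := hbdd y y
    rw [Nat.card_eq_fintype_card, Fintype.card_subtype] at this
    refine le_trans (le_of_eq ?_) this
    congr!
  set W : ι → Finset (Fin (Δ + 1) → ι) := fun y =>
    (Fintype.piFinset fun _ => Q y).filter fun w => s' < 4 * (separators D w).card with hW
  have hsub : {f | ¬sBounded H (wl2VertexEquiv H (refineColor c f)) s'} ⊆
      ⋃ y ∈ (univ : Finset ι), ⋃ w ∈ W y, {f | ∀ v ∈ separators D w, f v = false} := by
    intro f hf
    obtain ⟨y, w, hw, hcard, hI⟩ := exists_separators_not_individualised hs' hΔ hdeg hf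
    simp only [Set.mem_iUnion]
    refine ⟨y, mem_univ y, w, mem_filter.2 ⟨Fintype.mem_piFinset.2 fun i => ?_, hcard⟩, hI⟩
    exact mem_filter.2 ⟨mem_univ _, hw i⟩
  have hWs : ∀ y, (W y).card ≤ s ^ (Δ + 1) := fun y => by
    refine (card_filter_le _ _).trans ?_
    rw [Fintype.card_piFinset_const]
    exact Nat.pow_le_pow_left (hQs y) _
  have hcyl : ∀ y, ∀ w ∈ W y, bernoulliProduct ι q {f | ∀ v ∈ separators D w, f v = false} ≤
      ENNReal.ofReal (Real.exp (-(s' / 4 : ℝ))) := fun y w hw => by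
    refine (bernoulliProduct_cylinder_le hq _).trans (ENNReal.ofReal_le_ofReal ?_)
    have : (s' : ℝ) < 4 * (separators D w).card := by exact_mod_cast (mem_filter.1 hw).2
    exact Real.exp_le_exp.2 (by linarith)
  calc _ ≤ ∑ y : ι, ∑ w ∈ W y,
        bernoulliProduct ι q {f | ∀ v ∈ separators D w, f v = false} :=
      (measure_mono hsub).trans ((measure_biUnion_finset_le _ _).trans
        (sum_le_sum fun y _ => measure_biUnion_finset_le _ _))
    _ ≤ ∑ _y : ι, (s ^ (Δ + 1) : ℕ) • ENNReal.ofReal (Real.exp (-(s' / 4 : ℝ))) :=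
      sum_le_sum fun y _ => (sum_le_card_nsmul _ _ _ (hcyl y)).trans
        (nsmul_le_nsmul_left (zero_le) (hWs y))
    _ = _ := by
      rw [sum_const, card_univ, ENNReal.ofReal_mul (by positivity),
        ENNReal.ofReal_mul (by positivity), ENNReal.ofReal_natCast,
        ENNReal.ofReal_pow (by positivity), ENNReal.ofReal_natCast]
      simp [mul_assoc]

/-- The failure probability bound is at most `1 / n` in the relevant range of parameters. -/
theorem union_bound_le_inv {n s s' Δ : ℕ} (hn : 1 ≤ n) (hs : 1 ≤ s) (hΔ : 0 < Δ)
    (h1 : 100 * Real.log n ≤ s') (h2 : 10 * Real.log s ≤ (s' : ℝ) / (8 * Δ)) :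
    (n : ℝ) * (s : ℝ) ^ (Δ + 1) * Real.exp (-(s' / 4 : ℝ)) ≤ (n : ℝ)⁻¹ := by
  have hn' : (0 : ℝ) < n := by exact_mod_cast hn
  have hs' : (0 : ℝ) < s := by exact_mod_cast hs
  have hΔ' : (1 : ℝ) ≤ Δ := by exact_mod_cast hΔ
  have hlog : 0 ≤ Real.log n := Real.log_nonneg (by exact_mod_cast hn)
  have hlogs : 0 ≤ Real.log s := Real.log_nonneg (by exact_mod_cast hs)
  rw [le_div_iff₀ (by positivity)] at h2
  have h3 : ((Δ + 1 : ℕ) : ℝ) * Real.log s ≤ s' / 40 := by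
    push_cast
    nlinarith
  have e1 : (n : ℝ) = Real.exp (Real.log n) := (Real.exp_log hn').symm
  have e2 : (s : ℝ) ^ (Δ + 1) = Real.exp (((Δ + 1 : ℕ) : ℝ) * Real.log s) := by
    rw [Real.exp_nat_mul, Real.exp_log hs']
  calc _ = Real.exp (Real.log n + ((Δ + 1 : ℕ) : ℝ) * Real.log s + -(s' / 4 : ℝ)) := by
        rw [Real.exp_add, Real.exp_add, ← e2, ← e1]
    _ ≤ Real.exp (-Real.log n) := Real.exp_le_exp.2 (by linarith)
    _ = _ := by rw [Real.exp_neg, ← e1]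

end Probability

/-- Lemma 5.8.
Suppose `s ≥ s' ≥ 100 log n` and `s'/(8Δ) ≥ 10 log s`, `H` is an `n`-vertex graph with an
equitable colouring `c` such that `D(H,c)` is `s`-bounded and has maximum degree at most `Δ`.
If each vertex independently gets a brand-new unique colour with probability at least `0.7`,
then whp `D(H, V*c')` is `s'`-bounded, where `V*c'` is the vertex colouring produced by the
2-dimensional Weisfeiler–Leman algorithm started from the refined colouring `c'`. -/
theorem stmt16 (s s' Δ : ℕ → ℕ) (Ω : ℕ → Type) (H : ∀ n : ℕ, SimpleGraph (Fin n))
    (c : ∀ n : ℕ, Fin n → Ω n)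
    (hss' : ∀ n, s' n ≤ s n)
    (hs' : ∀ᶠ n : ℕ in atTop, 100 * Real.log n ≤ (s' n : ℝ))
    (hΔ : ∀ᶠ n : ℕ in atTop, 10 * Real.log (s n) ≤ (s' n : ℝ) / (8 * Δ n))
    (heq : ∀ n, IsEquitable (H n) (c n))
    (hbdd : ∀ n, sBounded (H n) (fun x y => c n x = c n y) (s n))
    (hdeg : ∀ n, ∀ v : Fin n,
      Nat.card {u : Fin n // (disparity (H n) fun x y => c n x = c n y).Adj v u} ≤ Δ n)
    (q : ∀ n : ℕ, Fin n → ℝ) (hq : ∀ n v, 0.7 ≤ q n v ∧ q n v ≤ 1) :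
    Tendsto (fun n : ℕ =>
      bernoulliProduct (Fin n) (q n)
        {f | sBounded (H n) (wl2VertexEquiv (H n) (refineColor (c n) f)) (s' n)})
      atTop (nhds 1) := by
  have hprob : ∀ n, IsProbabilityMeasure (bernoulliProduct (Fin n) (q n)) := fun n =>
    isProbabilityMeasure_bernoulliProduct fun i => ⟨by linarith [(hq n i).1], (hq n i).2⟩
  have hbad : ∀ᶠ n : ℕ in atTop, bernoulliProduct (Fin n) (q n)
      {f | ¬sBounded (H n) (wl2VertexEquiv (H n) (refineColor (c n) f)) (s' n)} ≤
      (n : ENNReal)⁻¹ := by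
    filter_upwards [hs', hΔ, eventually_ge_atTop 2] with n h1 h2 hn
    have hlog : (0.6931471803 : ℝ) < Real.log n :=
      Real.log_two_gt_d9.trans_le (Real.log_le_log two_pos (by exact_mod_cast hn))
    have hs2 : 2 ≤ s' n := by
      have : (2 : ℝ) ≤ s' n := by linarith
      exact_mod_cast this
    have hss : 2 ≤ s n := hs2.trans (hss' n)
    have hΔ0 : 0 < Δ n := by
      rw [Nat.pos_iff_ne_zero]
      intro h0
      have : 0 < Real.log (s n) := Real.log_pos (by exact_mod_cast hss)
      rw [h0] at h2
      simp only [Nat.cast_zero, mul_zero, div_zero] at h2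
      linarith
    refine (bernoulliProduct_not_sBounded_le hs2 hΔ0 (hbdd n) (hdeg n) (hq n)).trans ?_
    rw [Fintype.card_fin, ← ENNReal.ofReal_natCast n,
      ← ENNReal.ofReal_inv_of_pos (by positivity)]
    exact ENNReal.ofReal_le_ofReal (union_bound_le_inv (by omega) (by omega) hΔ0 h1 h2)
  have hlim : Tendsto (fun n : ℕ => 1 - (n : ENNReal)⁻¹) atTop (nhds 1) := by
    simpa using ENNReal.Tendsto.sub tendsto_const_nhds ENNReal.tendsto_inv_nat_nhds_zero
      (.inl ENNReal.one_ne_top)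
  refine tendsto_of_tendsto_of_tendsto_of_le_of_le' hlim tendsto_const_nhds ?_
    (.of_forall fun n => prob_le_one)
  filter_upwards [hbad] with n hn
  rw [tsub_le_iff_right, ← (hprob n).measure_univ]
  refine (measure_univ_le_add_compl
    {f | sBounded (H n) (wl2VertexEquiv (H n) (refineColor (c n) f)) (s' n)}).trans ?_
  exact add_le_add_right hn _
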